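/- arXiv:2305.15063 — 5 statements merged into one kernel-verified Lean document; each statement's English description precedes it below -/
import Mathlib

section
/- The degree sequence 5, 5, 4, 4, 3, 3 is unigraphic: any two simple graphs on 6 vertices, each having two vertices of degree 5, two vertices of degree 4 and two vertices of degree 3, are isomorphic. (The unique realisation is the polyhedron obtained from the tetrahedron by two face splittings.) -/
/-- the standard adjacency: everything except the path 2-5-4-3 in the complement -/
def stdAdj (i j : Fin 6) : Bool :=
  !(i == j) && !(s(i, j) == s(2, 5)) && !(s(i, j) == s(5, 4)) && !(s(i, j) == s(4, 3))

set_option maxHeartbeats 4000000 in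
theorem std_of_degrees (x : Fin 6 → Fin 6 → ℕ) (hx : ∀ i j, x i j ≤ 1)
    (hs : ∀ i j, x i j = x j i) (h0 : ∀ i, x i i = 0)
    (hd : ∀ i, ∑ j, x i j = (![5, 5, 4, 4, 3, 3] : Fin 6 → ℕ) i) :
    (∀ i j, x i j = (stdAdj i j).toNat) ∨
    (∀ i j, x i j = (stdAdj (Equiv.swap 4 5 i) (Equiv.swap 4 5 j)).toNat) := by
  have d0 := hd 0
  have d1 := hd 1
  have d2 := hd 2
  have d3 := hd 3
  have d4 := hd 4
  have d5 := hd 5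
  simp only [Fin.sum_univ_six, h0] at d0 d1 d2 d3 d4 d5
  rw [hs 1 0] at d1
  rw [hs 2 0, hs 2 1] at d2
  rw [hs 3 0, hs 3 1, hs 3 2] at d3
  rw [hs 4 0, hs 4 1, hs 4 2, hs 4 3] at d4
  rw [hs 5 0, hs 5 1, hs 5 2, hs 5 3, hs 5 4] at d5
  simp at d0 d1 d2 d3 d4 d5
  have := hx 0 1
  have := hx 0 2
  have := hx 0 3
  have := hx 0 4
  have := hx 0 5
  have := hx 1 2
  have := hx 1 3
  have := hx 1 4
  have := hx 1 5
  have := hx 2 3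
  have := hx 2 4
  have := hx 2 5
  have := hx 3 4
  have := hx 3 5
  have := hx 4 5
  have a01 : x 0 1 = 1 := by omega
  have a02 : x 0 2 = 1 := by omega
  have a03 : x 0 3 = 1 := by omega
  have a04 : x 0 4 = 1 := by omega
  have a05 : x 0 5 = 1 := by omega
  have a12 : x 1 2 = 1 := by omega
  have a13 : x 1 3 = 1 := by omega
  have a14 : x 1 4 = 1 := by omega
  have a15 : x 1 5 = 1 := by omega
  have a23 : x 2 3 = 1 := by omega
  have a45 : x 4 5 = 0 := by omega
  have key : ∀ y : Fin 6 → Fin 6 → ℕ, (∀ i j, y i j = y j i) → (∀ i, y i i = 0) →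
      (∀ i j, i < j → x i j = y i j) → ∀ i j, x i j = y i j := by
    intro y ys y0 h i j
    rcases lt_trichotomy i j with hij | rfl | hij
    · exact h i j hij
    · rw [h0, y0]
    · rw [hs, ys, h j i hij]
  rcases (by omega : x 2 4 = 1 ∨ x 2 4 = 0) with a24 | a24
  · left
    have a25 : x 2 5 = 0 := by omega
    have a34 : x 3 4 = 0 := by omega
    have a35 : x 3 5 = 1 := by omega
    refine key (fun i j => (stdAdj i j).toNat) (by decide) (by decide) ?_
    intro i j hij
    fin_cases i <;> fin_cases j <;> first
      | exact absurd hij (by decide)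
      | (simp only [Fin.zero_eta, Fin.mk_one, Fin.reduceFinMk, a01, a02, a03, a04, a05, a12, a13, a14, a15,
          a23, a24, a25, a34, a35, a45]; decide)
  · right
    have a25 : x 2 5 = 1 := by omega
    have a34 : x 3 4 = 1 := by omega
    have a35 : x 3 5 = 0 := by omega
    refine key (fun i j => (stdAdj (Equiv.swap 4 5 i) (Equiv.swap 4 5 j)).toNat)
      (by decide) (by decide) ?_
    intro i j hij
    fin_cases i <;> fin_cases j <;> first
      | exact absurd hij (by decide)
      | (simp only [Fin.zero_eta, Fin.mk_one, Fin.reduceFinMk, a01, a02, a03, a04, a05, a12, a13, a14, a15,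
          a23, a24, a25, a34, a35, a45]; decide)

theorem exists_perm_of_map_eq {n : ℕ} (f g : Fin n → ℕ)
    (h : Multiset.map f Finset.univ.val = Multiset.map g Finset.univ.val) :
    ∃ σ : Equiv.Perm (Fin n), g = f ∘ σ := by
  have hp : (List.ofFn f).Perm (List.ofFn g) := by
    rw [List.ofFn_eq_map, List.ofFn_eq_map]
    exact Multiset.coe_eq_coe.1 h
  have h1 := ((Equiv.Perm.ofFn_comp_perm (Tuple.sort f) f).trans
    (hp.trans (Equiv.Perm.ofFn_comp_perm (Tuple.sort g) g).symm)).eq_of_pairwise'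
      (Tuple.monotone_sort f).sortedLE_ofFn.pairwise
      (Tuple.monotone_sort g).sortedLE_ofFn.pairwise
  have h2 := List.ofFn_injective h1
  refine ⟨(Tuple.sort g).symm.trans (Tuple.sort f), ?_⟩
  funext i
  have := congrFun h2 ((Tuple.sort g).symm i)
  simpa using this.symm

theorem exists_std (G : SimpleGraph (Fin 6)) [DecidableRel G.Adj]
    (h : Multiset.map (fun v => G.degree v) Finset.univ.val
        = ({5, 5, 4, 4, 3, 3} : Multiset ℕ)) :
    ∃ e : Fin 6 ≃ Fin 6, ∀ i j, G.Adj (e i) (e j) ↔ stdAdj i j = true := by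
  have h2 : ({5, 5, 4, 4, 3, 3} : Multiset ℕ) =
      Multiset.map (![5, 5, 4, 4, 3, 3] : Fin 6 → ℕ) Finset.univ.val := by decide
  rw [h2] at h
  obtain ⟨σ, hσ⟩ := exists_perm_of_map_eq _ _ h
  have conv : ∀ i j (b : Bool), (if G.Adj i j then 1 else 0) = b.toNat → (G.Adj i j ↔ b = true) := by
    intro i j b
    cases b <;> by_cases hh : G.Adj i j <;> simp [hh]
  rcases std_of_degrees (fun i j => if G.Adj (σ i) (σ j) then 1 else 0)
    (by intro i j; split_ifs <;> simp)
    (by intro i j; simp only [G.adj_comm]) (by simp)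
    (by
      intro i
      rw [hσ]
      simp only [Function.comp]
      rw [Equiv.sum_comp σ (fun j => if G.Adj (σ i) j then 1 else 0)]
      rw [← SimpleGraph.card_neighborFinset_eq_degree, SimpleGraph.neighborFinset_eq_filter]
      simp) with H | H
  · exact ⟨σ, fun i j => conv _ _ _ (H i j)⟩
  · refine ⟨(Equiv.swap 4 5).trans σ, fun i j => ?_⟩
    have := conv _ _ _ (H (Equiv.swap 4 5 i) (Equiv.swap 4 5 j))
    simpa using this

/-- **The degree sequence `5, 5, 4, 4, 3, 3` is unigraphic.**
Any two simple graphs on 6 vertices, each with two vertices of degree 5, two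
vertices of degree 4 and two vertices of degree 3, are isomorphic. -/
theorem unigraphic_554433 :
    ∀ (G H : SimpleGraph (Fin 6)) [DecidableRel G.Adj] [DecidableRel H.Adj],
      Multiset.map (fun v => G.degree v) Finset.univ.val
        = ({5, 5, 4, 4, 3, 3} : Multiset ℕ) →
      Multiset.map (fun v => H.degree v) Finset.univ.val
        = ({5, 5, 4, 4, 3, 3} : Multiset ℕ) →
      Nonempty (G ≃g H) := by
  intro G H _ _ hG hH
  obtain ⟨e, he⟩ := exists_std G hG
  obtain ⟨f, hf⟩ := exists_std H hH
  refine ⟨⟨e.symm.trans f, ?_⟩⟩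
  intro a b
  have h1 := he (e.symm a) (e.symm b)
  have h2 := hf (e.symm a) (e.symm b)
  simp only [Equiv.apply_symm_apply] at h1
  simp only [Equiv.trans_apply]
  exact h2.trans h1.symm
end

section
/- The degree sequence 6, 6, 6, 6, 3, 3, 3, 3 is unigraphic: any two simple graphs on 8 vertices, each having four vertices of degree 6 and four vertices of degree 3, are isomorphic. (The unique realisation is the polyhedron obtained from the tetrahedron by four face splittings.) -/
def canonG : SimpleGraph (Fin 4 ⊕ Fin 4) where
  Adj u v := match u, v with
    | .inl i, .inl j => i ≠ j
    | .inl i, .inr j => i ≠ j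
    | .inr i, .inl j => i ≠ j
    | .inr _, .inr _ => False
  symm := ⟨by rintro (i | i) (j | j) h <;> simp_all [eq_comm]⟩
  loopless := ⟨by rintro (i | i) h <;> simp_all⟩

theorem row_miss : ∀ r : Fin 4 → Bool, (∑ j, (if r j then 1 else 0) = 3) →
    ∃ k, ∀ j, r j = true ↔ k ≠ j := by decide

theorem toCanon (G : SimpleGraph (Fin 8)) [DecidableRel G.Adj]
    (h : Multiset.map (fun v => G.degree v) Finset.univ.val
        = ({6, 6, 6, 6, 3, 3, 3, 3} : Multiset ℕ)) : Nonempty (canonG ≃g G) := by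
  have h63 : ∀ v, G.degree v = 6 ∨ G.degree v = 3 := by
    intro v
    have : G.degree v ∈ Multiset.map (fun v => G.degree v) Finset.univ.val :=
      Multiset.mem_map_of_mem _ (Finset.mem_univ v)
    rw [h] at this
    simpa using this
  have hc : Fintype.card {v // G.degree v = 6} = 4 := by
    have := congrArg (Multiset.count 6) h
    rw [Multiset.count_map] at this
    rw [Fintype.card_subtype]
    have h2 : Multiset.count 6 ({6, 6, 6, 6, 3, 3, 3, 3} : Multiset ℕ) = 4 := by decide
    rw [h2] at this
    rw [← this]
    simp only [Finset.card, Finset.filter_val, eq_comm]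
  have hc' : Fintype.card {v // ¬ G.degree v = 6} = 4 := by
    rw [Fintype.card_subtype_compl, hc]; simp
  let e1 := (Fintype.equivFinOfCardEq hc).symm
  let e2 := (Fintype.equivFinOfCardEq hc').symm
  let e : Fin 4 ⊕ Fin 4 ≃ Fin 8 := (Equiv.sumCongr e1 e2).trans (Equiv.sumCompl _)
  have hl : ∀ i, G.degree (e (.inl i)) = 6 := fun i => (e1 i).2
  have hr : ∀ i, G.degree (e (.inr i)) = 3 := fun i => (h63 _).resolve_left (e2 i).2
  clear_value e
  have hdeg : ∀ v, G.degree v = (∑ j, if G.Adj v (e (.inl j)) then 1 else 0)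
      + ∑ j, if G.Adj v (e (.inr j)) then 1 else 0 := by
    intro v
    rw [← Fintype.sum_sum_type (fun s => if G.Adj v (e s) then 1 else 0),
      e.sum_comp (fun w => if G.Adj v w then 1 else 0), ← Finset.card_filter,
      ← G.card_neighborFinset_eq_degree, G.neighborFinset_eq_filter]
  obtain ⟨x, hx⟩ : ∃ x : Fin 4 ⊕ Fin 4 → Fin 4 ⊕ Fin 4 → ℕ,
      x = fun s t => if G.Adj (e s) (e t) then 1 else 0 := ⟨_, rfl⟩
  have hx' : ∀ s t, (if G.Adj (e s) (e t) then 1 else 0) = x s t := by intros; rw [hx]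
  have x1 : ∀ s t, x s t ≤ 1 := by intro s t; rw [hx]; dsimp only; split_ifs <;> simp
  have x0 : ∀ s, x s s = 0 := by intro s; simp [hx]
  have xs : ∀ s t, x s t = x t s := by intro s t; simp [hx, G.adj_comm]
  have xa : ∀ s t, G.Adj (e s) (e t) ↔ x s t = 1 := by intro s t; simp [hx]
  have dl : ∀ i, (∑ j, x (.inl i) (.inl j)) + ∑ j, x (.inl i) (.inr j) = 6 := by
    intro i; rw [← hl i, hdeg]; simp only [hx']
  have dr : ∀ i, (∑ j, x (.inr i) (.inl j)) + ∑ j, x (.inr i) (.inr j) = 3 := by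
    intro i; rw [← hr i, hdeg]; simp only [hx']
  have rl : ∀ i, ∑ j, x (.inl i) (.inl j) ≤ 3 := by
    intro i
    have a := x0 (.inl i)
    have b := fun j => x1 (.inl i) (.inl j)
    have b0 := b 0
    have b1 := b 1
    have b2 := b 2
    have b3 := b 3
    rw [Fin.sum_univ_four]
    fin_cases i <;> simp at * <;> omega
  have cross : ∑ i, ∑ j, x (.inl i) (.inr j) = ∑ i, ∑ j, x (.inr i) (.inl j) := by
    rw [Finset.sum_comm]
    exact Finset.sum_congr rfl fun i _ => Finset.sum_congr rfl fun j _ => xs _ _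
  have key : ∀ i, (∑ j, x (.inl i) (.inl j) = 3) ∧ (∑ j, x (.inr i) (.inr j) = 0) := by
    rw [Fin.sum_univ_four (fun i => ∑ j, x (.inl i) (.inr j)),
      Fin.sum_univ_four (fun i => ∑ j, x (.inr i) (.inl j))] at cross
    have a := rl 0
    have b := rl 1
    have c := rl 2
    have d := rl 3
    have a1 := dl 0
    have b1 := dl 1
    have c1 := dl 2
    have d1 := dl 3
    have a2 := dr 0
    have b2 := dr 1
    have c2 := dr 2
    have d2 := dr 3
    intro i
    fin_cases i <;> simp only [Fin.zero_eta, Fin.mk_one, Fin.reduceFinMk] <;> omega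
  have ll : ∀ i j, x (.inl i) (.inl j) = 1 ↔ i ≠ j := by
    intro i j
    have k := (key i).1
    have a := x0 (.inl i)
    have b := fun j => x1 (.inl i) (.inl j)
    have b0 := b 0
    have b1 := b 1
    have b2 := b 2
    have b3 := b 3
    rw [Fin.sum_univ_four] at k
    clear * - k a b0 b1 b2 b3
    fin_cases i <;> fin_cases j <;> simp at * <;> omega
  have rr : ∀ i j, x (.inr i) (.inr j) = 0 := by
    intro i j
    exact (Finset.sum_eq_zero_iff.1 (key i).2) j (Finset.mem_univ j)
  have miss : ∀ (f : Fin 4 → ℕ), (∀ j, f j ≤ 1) → ∑ j, f j = 3 → ∃ k, ∀ j, f j = 1 ↔ k ≠ j := by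
    intro f hf hs
    have hh : ∀ j, (if (decide (f j = 1)) = true then 1 else 0) = f j := by
      intro j; have := hf j; simp; split_ifs <;> omega
    obtain ⟨k, hk⟩ := row_miss (fun j => decide (f j = 1)) (by simp only [hh]; exact hs)
    exact ⟨k, by simpa using hk⟩
  have ml : ∀ i, ∃ k, ∀ j, x (.inl i) (.inr j) = 1 ↔ k ≠ j := fun i =>
    miss _ (fun j => x1 _ _) (by have := dl i; have := key i; omega)
  have mr : ∀ i, ∃ k, ∀ j, x (.inr i) (.inl j) = 1 ↔ k ≠ j := fun i =>
    miss _ (fun j => x1 _ _) (by have := dr i; have := key i; omega)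
  choose f hf using ml
  choose g hg using mr
  have hfg : ∀ i j, f i = j ↔ g j = i := by
    intro i j
    have a := hf i j
    have b := hg j i
    rw [xs, b] at a
    exact (not_iff_not.1 a).symm
  let p : Fin 4 ≃ Fin 4 := ⟨f, g, fun i => (hfg _ _).1 rfl, fun j => (hfg _ _).2 rfl⟩
  have hp : ∀ i, p i = f i := fun _ => rfl
  refine ⟨⟨(Equiv.sumCongr (Equiv.refl _) p).trans e, ?_⟩⟩
  rintro (i | i) (j | j)
  · simp [xa, ll, canonG]
  · simp only [Equiv.trans_apply, Equiv.sumCongr_apply, Sum.map_inr, Sum.map_inl, xa, hf, canonG, ← hp]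
    simp
  · simp only [Equiv.trans_apply, Equiv.sumCongr_apply, Sum.map_inr, Sum.map_inl, xa, xs (.inr _) (.inl _), canonG]
    simp [hf, ← hp, eq_comm]
  · simp [xa, rr, canonG]

/-- **The degree sequence `6, 6, 6, 6, 3, 3, 3, 3` is unigraphic.**
Any two simple graphs on 8 vertices, each with four vertices of degree 6 and
four vertices of degree 3, are isomorphic. -/
theorem unigraphic_66663333 :
    ∀ (G H : SimpleGraph (Fin 8)) [DecidableRel G.Adj] [DecidableRel H.Adj],
      Multiset.map (fun v => G.degree v) Finset.univ.val
        = ({6, 6, 6, 6, 3, 3, 3, 3} : Multiset ℕ) →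
      Multiset.map (fun v => H.degree v) Finset.univ.val
        = ({6, 6, 6, 6, 3, 3, 3, 3} : Multiset ℕ) →
      Nonempty (G ≃g H) := by
  intro G H _ _ hG hH
  obtain ⟨a⟩ := toCanon G hG
  obtain ⟨b⟩ := toCanon H hH
  exact ⟨a.symm.trans b⟩
end

section
/- Let G be a simple graph on p vertices with exactly 3p - 6 edges such that exactly three vertices x, y, z of G have degree at least 4 and all remaining p - 3 vertices have degree exactly 3. Then each of x, y, z has degree exactly p - 1, i.e., each of x, y, z is adjacent to every other vertex of G. -/
/-- **Triangulations with exactly three vertices of degree at least 4 (case m = 3).**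
If a simple graph on `p` vertices has exactly `3p - 6` edges, exactly three
vertices `x, y, z` of degree at least 4, and all the remaining `p - 3` vertices
have degree exactly 3, then each of `x, y, z` has degree exactly `p - 1`, i.e.
each of `x, y, z` is adjacent to every other vertex. -/
theorem triangulation_three_big_vertices {V : Type*} [Fintype V] [DecidableEq V]
    (G : SimpleGraph V) [DecidableRel G.Adj] (x y z : V)
    (hxy : x ≠ y) (hxz : x ≠ z) (hyz : y ≠ z)
    (hx : 4 ≤ G.degree x) (hy : 4 ≤ G.degree y) (hz : 4 ≤ G.degree z)
    (hsmall : ∀ w, w ≠ x → w ≠ y → w ≠ z → G.degree w = 3)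
    (hedges : (G.edgeFinset.card : ℤ) = 3 * (Fintype.card V : ℤ) - 6) :
    (G.degree x = Fintype.card V - 1 ∧ G.degree y = Fintype.card V - 1 ∧
      G.degree z = Fintype.card V - 1) ∧
    (∀ w, w ≠ x → G.Adj x w) ∧ (∀ w, w ≠ y → G.Adj y w) ∧
      (∀ w, w ≠ z → G.Adj z w) := by
  have hsum := G.sum_degrees_eq_twice_card_edges
  have hc : ({x, y, z} : Finset V).card = 3 := Finset.card_eq_three.mpr ⟨x, y, z, hxy, hxz, hyz, rfl⟩
  have h1 : ∑ v ∈ ({x, y, z} : Finset V), G.degree v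
      = G.degree x + (G.degree y + G.degree z) := by
    rw [Finset.sum_insert (by simp [hxy, hxz]), Finset.sum_pair hyz]
  have h2 : ∑ v ∈ ({x, y, z} : Finset V)ᶜ, G.degree v
      = ({x, y, z} : Finset V)ᶜ.card * 3 := by
    apply Finset.sum_const_nat
    intro w hw
    simp only [Finset.mem_compl, Finset.mem_insert, Finset.mem_singleton, not_or] at hw
    exact hsmall w hw.1 hw.2.1 hw.2.2
  have h3 := Finset.sum_add_sum_compl ({x, y, z} : Finset V) (fun v => G.degree v)
  have h4 := Finset.card_add_card_compl ({x, y, z} : Finset V)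
  have bx := G.degree_lt_card_verts x
  have byy := G.degree_lt_card_verts y
  have bz := G.degree_lt_card_verts z
  have key : ∀ v, G.degree v = Fintype.card V - 1 → ∀ w, w ≠ v → G.Adj v w := by
    intro v hv w hw
    have hsub : G.neighborFinset v ⊆ Finset.univ.erase v := by
      intro u hu
      rw [SimpleGraph.mem_neighborFinset] at hu
      simp [hu.ne']
    have heq := Finset.eq_of_subset_of_card_le hsub (by
      rw [Finset.card_erase_of_mem (Finset.mem_univ v), Finset.card_univ,
        SimpleGraph.card_neighborFinset_eq_degree, hv])
    rw [← SimpleGraph.mem_neighborFinset, heq]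
    simp [hw]
  have ex : G.degree x = Fintype.card V - 1 := by omega
  have ey : G.degree y = Fintype.card V - 1 := by omega
  have ez : G.degree z = Fintype.card V - 1 := by omega
  exact ⟨⟨ex, ey, ez⟩, key x ex, key y ey, key z ez⟩
end

section
/- Let G be a simple graph on p vertices with exactly 3p - 6 edges such that exactly four vertices x, y, z, w of G have degree at least 4, these four vertices are pairwise adjacent, and all remaining p - 4 vertices have degree exactly 3. Then every vertex of degree 3 in G has all of its three neighbours among {x, y, z, w}; in particular each vertex of degree 3 is adjacent to exactly three of x, y, z, w, and no two vertices of degree 3 are adjacent to each other. -/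
/-- **Triangulations with exactly four pairwise adjacent vertices of degree at
least 4 (case m = 4).**
If a simple graph on `p` vertices has exactly `3p - 6` edges, exactly four
vertices `x, y, z, w` of degree at least 4 which are pairwise adjacent, and all
the remaining `p - 4` vertices have degree exactly 3, then every vertex of
degree 3 has all of its neighbours among `{x, y, z, w}`; in particular it is
adjacent to exactly three of `x, y, z, w`, and no two degree-3 vertices are
adjacent. -/
theorem triangulation_four_big_vertices {V : Type*} [Fintype V] [DecidableEq V]
    (G : SimpleGraph V) [DecidableRel G.Adj] (x y z w : V)
    (hx : 4 ≤ G.degree x) (hy : 4 ≤ G.degree y) (hz : 4 ≤ G.degree z)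
    (hw : 4 ≤ G.degree w)
    (hxy : G.Adj x y) (hxz : G.Adj x z) (hxw : G.Adj x w)
    (hyz : G.Adj y z) (hyw : G.Adj y w) (hzw : G.Adj z w)
    (hsmall : ∀ v, v ∉ ({x, y, z, w} : Set V) → G.degree v = 3)
    (hedges : (G.edgeFinset.card : ℤ) = 3 * (Fintype.card V : ℤ) - 6) :
    (∀ v, v ∉ ({x, y, z, w} : Set V) → G.neighborSet v ⊆ {x, y, z, w}) ∧
    (∀ v, v ∉ ({x, y, z, w} : Set V) →
      ((G.neighborFinset v) ∩ ({x, y, z, w} : Finset V)).card = 3) ∧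
    (∀ u v, u ∉ ({x, y, z, w} : Set V) → v ∉ ({x, y, z, w} : Set V) →
      ¬ G.Adj u v) := by
  classical
  set S : Finset V := {x, y, z, w} with hS
  have hSet : ∀ v, v ∉ ({x, y, z, w} : Set V) ↔ v ∉ S := by intro v; simp [hS]
  have hcard : S.card = 4 := by
    have h1 := hxy.ne
    have h2 := hxz.ne
    have h3 := hxw.ne
    have h4 := hyz.ne
    have h5 := hyw.ne
    have h6 := hzw.ne
    rw [hS, Finset.card_insert_of_notMem, Finset.card_insert_of_notMem,
        Finset.card_insert_of_notMem, Finset.card_singleton] <;> simp [*]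
  have hdeg : ∀ v, G.degree v = (G.neighborFinset v ∩ S).card + (G.neighborFinset v ∩ Sᶜ).card := by
    intro v
    rw [← G.card_neighborFinset_eq_degree, ← Finset.sdiff_eq_inter_compl,
      Finset.card_inter_add_card_sdiff]
  have hdc : ∑ s ∈ S, (G.neighborFinset s ∩ Sᶜ).card = ∑ v ∈ Sᶜ, (G.neighborFinset v ∩ S).card := by
    have h := Finset.sum_card_bipartiteAbove_eq_sum_card_bipartiteBelow
      (s := S) (t := Sᶜ) (fun a b => G.Adj a b)
    convert h using 3 with a ha a ha
    · ext b; simp [Finset.bipartiteAbove, and_comm]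
    · ext b; simp [Finset.bipartiteBelow, and_comm, G.adj_comm]
  have hin : ∑ s ∈ S, (G.neighborFinset s ∩ S).card ≤ 12 := by
    calc _ ≤ ∑ s ∈ S, 3 := by
          apply Finset.sum_le_sum
          intro s hs
          have h : G.neighborFinset s ∩ S ⊆ S.erase s := by
            intro b hb
            simp only [Finset.mem_inter, SimpleGraph.mem_neighborFinset] at hb
            exact Finset.mem_erase.2 ⟨hb.1.ne', hb.2⟩
          have := Finset.card_le_card h
          rw [Finset.card_erase_of_mem hs] at this
          omega
      _ = 12 := by simp [hcard]
  have hsum := G.sum_degrees_eq_twice_card_edges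
  rw [← Finset.sum_add_sum_compl S] at hsum
  have hA : ∑ v ∈ S, G.degree v
      = ∑ s ∈ S, (G.neighborFinset s ∩ S).card + ∑ s ∈ S, (G.neighborFinset s ∩ Sᶜ).card := by
    rw [← Finset.sum_add_distrib]
    exact Finset.sum_congr rfl fun v _ => hdeg v
  have hd3 : ∀ v ∈ Sᶜ, G.degree v = 3 := fun v hv =>
    hsmall v ((hSet v).2 (Finset.mem_compl.1 hv))
  have hB : ∑ v ∈ Sᶜ, G.degree v = ∑ v ∈ Sᶜ, 3 := Finset.sum_congr rfl hd3
  have hle : ∀ v ∈ Sᶜ, (G.neighborFinset v ∩ S).card ≤ 3 := by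
    intro v hv
    have := hd3 v hv
    have := hdeg v
    omega
  have hC : ∑ v ∈ Sᶜ, 3 = Sᶜ.card * 3 := by simp
  have hcc := Finset.card_add_card_compl S
  have hle' := Finset.sum_le_sum hle
  have heq : ∑ v ∈ Sᶜ, (G.neighborFinset v ∩ S).card = ∑ v ∈ Sᶜ, 3 := by omega
  have key := (Finset.sum_eq_sum_iff_of_le hle).1 heq
  have key2 : ∀ u v, u ∉ S → G.Adj u v → v ∈ S := by
    intro u v hu huv
    by_contra hv
    have h1 := key u (Finset.mem_compl.2 hu)
    have h2 := hd3 u (Finset.mem_compl.2 hu)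
    have h3 := hdeg u
    have h4 : (G.neighborFinset u ∩ Sᶜ).card = 0 := by omega
    rw [Finset.card_eq_zero] at h4
    have : v ∈ G.neighborFinset u ∩ Sᶜ := by simp [huv, hv]
    simp [h4] at this
  refine ⟨?_, ?_, ?_⟩
  · intro v hv b hb
    have := key2 v b ((hSet v).1 hv) hb
    by_contra hb'
    exact (hSet b).1 hb' this
  · intro v hv
    exact key v (Finset.mem_compl.2 ((hSet v).1 hv))
  · intro u v hu hv huv
    exact (hSet v).1 hv (key2 u v ((hSet u).1 hu) huv)
end

section
/- Let G be a simple graph on p vertices with exactly 3p - 6 edges such that exactly four vertices x, y, z, w of G have degree at least 4, these four vertices are pairwise adjacent, and all remaining p - 4 vertices have degree exactly 3. If G contains no subgraph isomorphic to the complete bipartite graph K(3,3), then for each 3-element subset T of {x, y, z, w} there is at most one vertex of degree 3 whose neighbourhood is exactly T; consequently p ≤ 8. -/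
theorem vec3_inj {V : Type*} {a b c : V} (hab : a ≠ b) (hac : a ≠ c) (hbc : b ≠ c) :
    Function.Injective (![a, b, c] : Fin 3 → V) := by
  intro i j h
  fin_cases i <;> fin_cases j <;> simp [hab, hac, hbc, hab.symm, hac.symm, hbc.symm] at h ⊢


/-- **Case m = 4 with no `K(3,3)` subgraph: at most one degree-3 vertex per
triple, hence at most 8 vertices.**
Let `G` be a simple graph on `p` vertices with exactly `3p - 6` edges, having
exactly four vertices `x, y, z, w` of degree at least 4, pairwise adjacent,
all other vertices being of degree exactly 3. If `G` contains no subgraph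
isomorphic to the complete bipartite graph `K(3,3)`, then for each 3-element
subset `T` of `{x, y, z, w}` there is at most one degree-3 vertex whose
neighbourhood is exactly `T`; consequently `p ≤ 8`. -/
theorem triangulation_four_big_vertices_no_K33 {V : Type*} [Fintype V] [DecidableEq V]
    (G : SimpleGraph V) [DecidableRel G.Adj] (x y z w : V)
    (hx : 4 ≤ G.degree x) (hy : 4 ≤ G.degree y) (hz : 4 ≤ G.degree z)
    (hw : 4 ≤ G.degree w)
    (hxy : G.Adj x y) (hxz : G.Adj x z) (hxw : G.Adj x w)
    (hyz : G.Adj y z) (hyw : G.Adj y w) (hzw : G.Adj z w)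
    (hsmall : ∀ v, v ∉ ({x, y, z, w} : Set V) → G.degree v = 3)
    (hedges : (G.edgeFinset.card : ℤ) = 3 * (Fintype.card V : ℤ) - 6)
    (hK33 : ¬ ∃ f : completeBipartiteGraph (Fin 3) (Fin 3) →g G,
      Function.Injective f) :
    (∀ T : Finset V, T ⊆ {x, y, z, w} → T.card = 3 →
      ∀ u v, u ∉ ({x, y, z, w} : Set V) → v ∉ ({x, y, z, w} : Set V) →
        G.neighborFinset u = T → G.neighborFinset v = T → u = v) ∧
    Fintype.card V ≤ 8 := by
  classical
  obtain ⟨S, hS⟩ : ∃ S : Finset V, S = {x, y, z, w} := ⟨_, rfl⟩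
  have hmem : ∀ v, v ∉ ({x, y, z, w} : Set V) ↔ v ∉ S := by
    intro v; subst hS; simp
  have hScard : S.card = 4 := by
    subst hS
    have h1 := hxy.ne
    have h2 := hxz.ne
    have h3 := hxw.ne
    have h4 := hyz.ne
    have h5 := hyw.ne
    have h6 := hzw.ne
    simp [*]
  have hclq : ∀ a ∈ S, ∀ b ∈ S, a ≠ b → G.Adj a b := by
    subst hS
    intro a ha b hb hab
    simp only [Finset.mem_insert, Finset.mem_singleton] at ha hb
    rcases ha with rfl | rfl | rfl | rfl <;> rcases hb with rfl | rfl | rfl | rfl <;>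
      first
      | exact absurd rfl hab
      | assumption
      | (apply SimpleGraph.Adj.symm; assumption)
  have key : ∀ T : Finset V, T ⊆ S → T.card = 3 →
      ∀ u v, u ∉ S → v ∉ S →
        G.neighborFinset u = T → G.neighborFinset v = T → u = v := by
    intro T hTS hT u v hu hv hNu hNv
    by_contra huv
    apply hK33
    have hsd : (S \ T).card = 1 := by
      rw [Finset.card_sdiff_of_subset hTS]; omega
    obtain ⟨s, hs⟩ := Finset.card_eq_one.1 hsd
    have hs' : s ∈ S \ T := by simp [hs]
    rw [Finset.mem_sdiff] at hs'
    obtain ⟨a, b, c, hab, hac, hbc, hTe⟩ := Finset.card_eq_three.1 hT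
    have hu' : ∀ t ∈ T, G.Adj u t := by
      intro t ht; rw [← hNu] at ht; simpa using ht
    have hv' : ∀ t ∈ T, G.Adj v t := by
      intro t ht; rw [← hNv] at ht; simpa using ht
    have hss : ∀ t ∈ T, G.Adj s t := by
      intro t ht
      exact hclq _ hs'.1 _ (hTS ht) (by rintro rfl; exact hs'.2 ht)
    have hus : u ≠ s := by rintro rfl; exact hu hs'.1
    have hvs : v ≠ s := by rintro rfl; exact hv hs'.1
    have hL : ∀ i t, t ∈ T → G.Adj ((![u, v, s] : Fin 3 → V) i) t := by
      intro i t ht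
      fin_cases i
      · exact hu' t ht
      · exact hv' t ht
      · exact hss t ht
    have hR : ∀ j, (![a, b, c] : Fin 3 → V) j ∈ T := by
      intro j; subst hTe; fin_cases j <;> simp
    refine ⟨⟨Sum.elim ![u, v, s] ![a, b, c], ?_⟩, ?_⟩
    · rintro (i | i) (j | j) h
      · simp at h
      · exact hL i _ (hR j)
      · exact (hL j _ (hR i)).symm
      · simp at h
    · change Function.Injective (Sum.elim ![u, v, s] ![a, b, c])
      apply Function.Injective.sumElim
      · exact vec3_inj huv hus hvs
      · exact vec3_inj hab hac hbc
      · intro i j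
        exact (hL i _ (hR j)).ne
  have hRcard : (Sᶜ).card + 4 = Fintype.card V := by
    have := Finset.card_compl_add_card S
    omega
  have hdeg : ∀ v ∉ S, G.degree v = 3 := fun v hv => hsmall v ((hmem v).2 hv)
  have indep : ∀ a b, a ∉ S → b ∉ S → ¬ G.Adj a b := by
    intro a b ha hb hab
    obtain ⟨Q, hQ⟩ : ∃ Q : Finset (Sym2 V),
      Q = {s(x, y), s(x, z), s(x, w), s(y, z), s(y, w), s(z, w)} := ⟨_, rfl⟩
    have hQc : Q.card ≤ 6 := by subst hQ; exact Finset.card_le_six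
    have hsub : G.edgeFinset ⊆ (Q ∪ (Sᶜ.erase a).biUnion (fun v => G.incidenceFinset v)) ∪
        (G.incidenceFinset a).erase s(a, b) := by
      intro e
      induction e using Sym2.ind with
      | _ c d =>
      intro he
      have hcd : G.Adj c d := by simpa using he
      have hgen : ∀ c d, G.Adj c d → c ∉ S →
          s(c, d) ∈ (Q ∪ (Sᶜ.erase a).biUnion (fun v => G.incidenceFinset v)) ∪
        (G.incidenceFinset a).erase s(a, b) := by
        intro c d hcd hc
        by_cases hca : c = a
        · subst hca
          by_cases hdb : d = b
          · subst hdb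
            apply Finset.mem_union_left
            apply Finset.mem_union_right
            rw [Finset.mem_biUnion]
            refine ⟨d, by simp [hb, hcd.ne'], ?_⟩
            simp [SimpleGraph.mem_incidenceFinset, SimpleGraph.incidenceSet, hcd]
          · apply Finset.mem_union_right
            rw [Finset.mem_erase]
            refine ⟨by simp [hdb, hab.ne], ?_⟩
            simp [SimpleGraph.mem_incidenceFinset, SimpleGraph.incidenceSet, hcd]
        · apply Finset.mem_union_left
          apply Finset.mem_union_right
          rw [Finset.mem_biUnion]
          refine ⟨c, by simp [hc, hca], ?_⟩
          simp [SimpleGraph.mem_incidenceFinset, SimpleGraph.incidenceSet, hcd]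
      by_cases hc : c ∈ S
      · by_cases hd : d ∈ S
        · apply Finset.mem_union_left
          apply Finset.mem_union_left
          have hne := hcd.ne
          subst hS hQ
          simp only [Finset.mem_insert, Finset.mem_singleton] at hc hd
          rcases hc with rfl | rfl | rfl | rfl <;> rcases hd with rfl | rfl | rfl | rfl <;>
            first
            | exact absurd rfl hne
            | simp
        · rw [Sym2.eq_swap (a := c) (b := d)]
          exact hgen d c hcd.symm hd
      · exact hgen c d hcd hc
    have h1 := Finset.card_le_card hsub
    have h2 := Finset.card_union_le (Q ∪ (Sᶜ.erase a).biUnion (fun v => G.incidenceFinset v))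
      ((G.incidenceFinset a).erase s(a, b))
    have h3 := Finset.card_union_le Q ((Sᶜ.erase a).biUnion (fun v => G.incidenceFinset v))
    have h4 : ((Sᶜ.erase a).biUnion (fun v => G.incidenceFinset v)).card ≤
        (Sᶜ.erase a).card * 3 := by
      apply Finset.card_biUnion_le_card_mul
      intro v hv
      rw [SimpleGraph.card_incidenceFinset_eq_degree, hdeg v (by simp at hv; exact hv.2)]
    have h5 : ((G.incidenceFinset a).erase s(a, b)).card = 2 := by
      rw [Finset.card_erase_of_mem, SimpleGraph.card_incidenceFinset_eq_degree, hdeg a ha]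
      simp [SimpleGraph.mem_incidenceFinset, SimpleGraph.incidenceSet, hab]
    have h6 : (Sᶜ.erase a).card + 1 = (Sᶜ).card :=
      Finset.card_erase_add_one (by simpa using ha)
    omega
  refine ⟨?_, ?_⟩
  · intro T hT hTc u v hu hv
    exact key T (hS ▸ hT) hTc u v ((hmem u).1 hu) ((hmem v).1 hv)
  · have hN : ∀ v ∉ S, G.neighborFinset v ∈ S.powersetCard 3 := by
      intro v hv
      rw [Finset.mem_powersetCard]
      refine ⟨?_, hdeg v hv⟩
      intro t ht
      by_contra htS
      exact indep v t hv htS (by simpa using ht)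
    have hle : (Sᶜ).card ≤ (S.powersetCard 3).card := by
      apply Finset.card_le_card_of_injOn (fun v => G.neighborFinset v)
      · intro v hv
        exact hN v (by simpa using hv)
      · intro u hu v hv huv
        have hu' : u ∉ S := by simpa using hu
        have hv' : v ∉ S := by simpa using hv
        have h := Finset.mem_powersetCard.1 (hN u hu')
        exact key _ h.1 h.2 u v hu' hv' rfl huv.symm
    rw [Finset.card_powersetCard, hScard] at hle
    have : Nat.choose 4 3 = 4 := by decide
    omega
end
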